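/- The number of fully commutative elements in the Coxeter group W(A_n) of type A_n (the symmetric group S_{n+1}) equals the Catalan number C_{n+1} = (1/(n+2))·binomial(2(n+1), n+1). -/

import Mathlib

open CoxeterSystem

def CommMove {B : Type*} (M : CoxeterMatrix B) (ω₁ ω₂ : List B) : Prop :=
  ∃ (l r : List B) (s t : B), M s t = 2 ∧ ω₁ = l ++ s :: t :: r ∧ ω₂ = l ++ t :: s :: r

def CommEquiv {B : Type*} (M : CoxeterMatrix B) : List B → List B → Prop :=
  Relation.ReflTransGen (CommMove M)

def IsRedexOf {B W : Type*} [Group W] {M : CoxeterMatrix B} (cs : CoxeterSystem M W)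
    (ω : List B) (w : W) : Prop :=
  cs.wordProd ω = w ∧ cs.IsReduced ω

def IsFC {B W : Type*} [Group W] {M : CoxeterMatrix B} (cs : CoxeterSystem M W) (w : W) : Prop :=
  ∀ ω₁ ω₂, IsRedexOf cs ω₁ w → IsRedexOf cs ω₂ w → CommEquiv M ω₁ ω₂

open Equiv

/-- The set of permutations of `ℕ` fixing every `p ≥ m`, a copy of the symmetric group `S_m`. -/
def permsBelow (m : ℕ) : Set (Perm ℕ) := {σ | ∀ p, m ≤ p → σ p = p}

/-- A permutation avoids the pattern 321. -/
def Avoids321 (σ : Perm ℕ) : Prop := ∀ a b c, a < b → b < c → ¬(σ b < σ a ∧ σ c < σ b)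

/-- The descending product `g (j + l - 1) * ⋯ * g (j + 1) * g j`. -/
def descProd {G : Type*} [Monoid G] (g : ℕ → G) (j : ℕ) : ℕ → G
  | 0 => 1
  | l + 1 => g (j + l) * descProd g j l

/-- The adjacent transposition exchanging `i` and `i + 1`. -/
def adjSwap (i : ℕ) : Perm ℕ := swap i (i + 1)

theorem adjSwap_apply (i p : ℕ) :
    adjSwap i p = if p = i then i + 1 else if p = i + 1 then i else p := by
  simp [adjSwap, swap_apply_def]

theorem adjSwap_mul_self (i : ℕ) : adjSwap i * adjSwap i = 1 := by
  simp [adjSwap]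

theorem descProd_adjSwap_apply (j l p : ℕ) : descProd adjSwap j l p =
    if p < j then p else if p = j then j + l else if p ≤ j + l then p - 1 else p := by
  induction l generalizing p with
  | zero => simp only [descProd, Perm.one_apply]; split_ifs <;> omega
  | succ l ih =>
    simp only [descProd, Perm.mul_apply, ih, adjSwap_apply]
    split_ifs <;> omega

theorem permsBelow_lt {m : ℕ} {σ : Perm ℕ} (h : σ ∈ permsBelow m) {p : ℕ} (hp : p < m) :
    σ p < m := by
  by_contra! hc
  have := σ.injective (h _ hc)
  omega

theorem permsBelow_finite (m : ℕ) : (permsBelow m).Finite := by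
  have e := Perm.subtypeEquivSubtypePerm (fun p : ℕ => p < m)
  have : Finite {f : Perm ℕ // ∀ a, ¬ a < m → f a = a} := Finite.of_equiv _ e
  have h : {f : Perm ℕ | ∀ a, ¬ a < m → f a = a}.Finite := this
  refine h.subset fun σ hσ a ha => hσ a (by omega)

theorem perm_eq_one_of_lt_succ {σ : Perm ℕ} (h : ∀ p, σ p < σ (p + 1)) : σ = 1 := by
  have hm : StrictMono σ := strictMono_nat_of_lt_succ h
  have hm' : StrictMono σ.symm := fun a b hab => by
    rw [← hm.lt_iff_lt]; simpa using hab
  ext p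
  have h1 := hm.le_apply (x := p)
  have h2 := hm'.le_apply (x := σ p)
  simp only [symm_apply_apply] at h2
  simp; omega


/-- 321-avoiding permutations of `{0, …, m - 1}` that increase from position `a` on. -/
def avoidsIncFrom (m a : ℕ) : Set (Perm ℕ) :=
  {σ | σ ∈ permsBelow m ∧ Avoids321 σ ∧ ∀ p, a ≤ p → σ p < σ (p + 1)}

theorem mul_descProd_mem {m j l : ℕ} (hjl : j + l = m) {u : Perm ℕ} (hu : u ∈ permsBelow m) :
    u * descProd adjSwap j l ∈ permsBelow (m + 1) := by
  intro p hp
  rw [Perm.mul_apply, descProd_adjSwap_apply]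
  have := hu p (by omega)
  grind

theorem exists_descProd_factor {m : ℕ} {σ : Perm ℕ} (h : σ ∈ permsBelow (m + 1)) {j l : ℕ}
    (hjl : j + l = m) (hj : σ j = m) :
    ∃ u ∈ permsBelow m, σ = u * descProd adjSwap j l := by
  refine ⟨σ * (descProd adjSwap j l)⁻¹, ?_, by simp⟩
  intro p hp
  rcases hp.eq_or_lt with rfl | hp
  · have : (descProd adjSwap j l)⁻¹ m = j := by
      rw [Perm.inv_eq_iff_eq, descProd_adjSwap_apply]; grind
    rw [Perm.mul_apply, this, hj]
  · have : (descProd adjSwap j l)⁻¹ p = p := by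
      rw [Perm.inv_eq_iff_eq, descProd_adjSwap_apply]; grind
    rw [Perm.mul_apply, this, h p hp]

theorem avoidsIncFrom_finite (m a : ℕ) : (avoidsIncFrom m a).Finite :=
  (permsBelow_finite m).subset fun _ h => h.1

theorem ncard_avoidsIncFrom_zero (m : ℕ) : (avoidsIncFrom m 0).ncard = 1 := by
  rw [Set.ncard_eq_one]
  refine ⟨1, Set.ext fun σ => ⟨fun h => perm_eq_one_of_lt_succ fun p => h.2.2 p p.zero_le, ?_⟩⟩
  rintro rfl
  refine ⟨fun p _ => rfl, fun a b c hab hbc h => ?_, fun p _ => ?_⟩ <;> simp at *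
  omega

theorem avoidsIncFrom_succ_self (m : ℕ) :
    avoidsIncFrom (m + 1) (m + 1) = avoidsIncFrom (m + 1) m := by
  ext σ
  refine ⟨fun h => ⟨h.1, h.2.1, fun p hp => ?_⟩,
    fun h => ⟨h.1, h.2.1, fun p hp => h.2.2 p (by omega)⟩⟩
  rcases hp.eq_or_lt with rfl | hp
  · have := h.1 (m + 1) le_rfl
    have := permsBelow_lt h.1 m.lt_succ_self
    omega
  · exact h.2.2 p hp

theorem ncard_avoidsIncFrom_succ_succ {m a : ℕ} (ha : a < m) :
    (avoidsIncFrom (m + 1) (a + 1)).ncard =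
      (avoidsIncFrom (m + 1) a).ncard + (avoidsIncFrom m (a + 1)).ncard := by
  obtain ⟨l, hl⟩ := Nat.exists_eq_add_of_lt ha
  have hal : a + (l + 1) = m := by omega
  have key : avoidsIncFrom (m + 1) (a + 1) \ avoidsIncFrom (m + 1) a =
      (avoidsIncFrom m (a + 1) \ avoidsIncFrom m a) ∪
        (fun u => u * descProd adjSwap a (l + 1)) '' avoidsIncFrom m a := by
    ext σ
    constructor
    · rintro ⟨⟨hσ, hav, hinc⟩, hn⟩
      have hd : σ (a + 1) < σ a := by
        by_contra! hc
        refine hn ⟨hσ, hav, fun p hp => ?_⟩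
        rcases hp.eq_or_lt with rfl | hp
        · exact lt_of_le_of_ne hc (σ.injective.ne (by omega))
        · exact hinc p hp
      by_cases hm : σ m = m
      · left
        refine ⟨⟨fun p hp => ?_, hav, hinc⟩, fun h => ?_⟩
        · rcases hp.eq_or_lt with rfl | hp
          · exact hm
          · exact hσ p hp
        · have := h.2.2 a le_rfl
          omega
      · right
        have hja : σ a = m := by
          have hj : σ (σ.symm m) = m := by simp
          have hjm : σ.symm m < m := by
            by_contra! hc
            rcases hc.eq_or_lt with hc | hc
            · rw [← hc] at hj; exact hm hj
            · have := hσ _ hc; omega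
          generalize σ.symm m = j at hj hjm
          have hlt : σ (j + 1) < m := by
            have h1 := permsBelow_lt hσ (p := j + 1) (by omega)
            have h2 : σ (j + 1) ≠ σ j := σ.injective.ne (by omega)
            omega
          have hja : j ≤ a := by
            by_contra! hc
            have := hinc j hc
            omega
          rcases hja.eq_or_lt with rfl | hja
          · exact hj
          · have h1 := permsBelow_lt hσ (p := a) (by omega)
            have h2 : σ a ≠ σ j := σ.injective.ne (by omega)
            exact (hav j a (a + 1) hja (by omega) ⟨by omega, hd⟩).elim
        obtain ⟨u, hu, rfl⟩ := exists_descProd_factor hσ hal hja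
        refine ⟨u, ⟨hu, ?_, ?_⟩, rfl⟩
        · have e : ∀ p, u p = (u * descProd adjSwap a (l + 1))
              (if p < a then p else if p < m then p + 1 else if p = m then a else p) := by
            intro p
            rw [Perm.mul_apply, descProd_adjSwap_apply]
            congr 1
            split_ifs <;> omega
          intro x y z hxy hyz hxyz
          have hzm : z < m := by
            by_contra! hc
            have := hu z hc
            have : u y < y + 1 ∨ u y < m := by
              by_cases hy : y < m
              · exact .inr (permsBelow_lt hu hy)
              · have := hu y (by omega); omega
            omega
          refine hav (if x < a then x else x + 1) (if y < a then y else y + 1)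
            (if z < a then z else z + 1) (by split_ifs <;> omega) (by split_ifs <;> omega) ?_
          have ex := e x
          have ey := e y
          have ez := e z
          grind
        · intro p hp
          by_cases hpm : p + 1 < m
          · have := hinc (p + 1) (by omega)
            simp only [Perm.mul_apply, descProd_adjSwap_apply] at this
            grind
          · have := hu (p + 1) (by omega)
            by_cases hpm : p < m
            · have := permsBelow_lt hu hpm
              omega
            · have := hu p (by omega)
              omega
    · rintro (⟨⟨hσ, hav, hinc⟩, hn⟩ | ⟨u, ⟨hu, hav, hinc⟩, rfl⟩)
      · exact ⟨⟨fun p hp => hσ p (by omega), hav, hinc⟩,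
          fun h => hn ⟨hσ, hav, h.2.2⟩⟩
      · have hmem := mul_descProd_mem hal hu
        have hval : ∀ p, (u * descProd adjSwap a (l + 1)) p =
            if p < a then u p else if p = a then m else if p ≤ m then u (p - 1) else p := by
          intro p
          rw [Perm.mul_apply, descProd_adjSwap_apply]
          have := hu p
          have := hu m le_rfl
          grind
        have hinc' : ∀ p, a + 1 ≤ p → (u * descProd adjSwap a (l + 1)) p <
            (u * descProd adjSwap a (l + 1)) (p + 1) := by
          intro p hp
          have h1 := hinc (p - 1) (by omega)
          have h2 := permsBelow_lt hu (p := p - 1)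
          rw [Nat.sub_add_cancel (by omega)] at h1
          rw [hval, hval]
          grind
        refine ⟨⟨hmem, ?_, hinc'⟩, fun h => ?_⟩
        · intro x y z hxy hyz hxyz
          beta_reduce at hxyz
          have hlt : ∀ p, p < m + 1 → (u * descProd adjSwap a (l + 1)) p < m + 1 :=
            fun p hp => permsBelow_lt hmem hp
          have hge : ∀ p, m + 1 ≤ p → (u * descProd adjSwap a (l + 1)) p = p := hmem
          have hzm : z ≤ m := by
            by_contra! hc
            have := hge z hc
            have := hlt y
            have := hge y
            omega
          by_cases hxa : x = a
          · have : StrictMonoOn (u * descProd adjSwap a (l + 1)) (Set.Ici (a + 1)) := by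
              apply strictMonoOn_of_lt_succ Set.ordConnected_Ici
              intro p _ hp _
              exact hinc' p hp
            have := this (a := y) (b := z) (by simp; omega) (by simp; omega) hyz
            omega
          · have hya : y ≠ a := by
              rintro rfl
              have := hval y
              have := hlt x
              grind
            have hza : z ≠ a := by
              rintro rfl
              have := hval z
              have := hlt y
              grind
            refine hav (if x < a then x else x - 1) (if y < a then y else y - 1)
              (if z < a then z else z - 1) (by grind) (by grind) ?_
            simp only [hval] at hxyz
            grind
        · have h1 := h.2.2 a le_rfl
          have h2 := permsBelow_lt hmem (p := a + 1) (by omega)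
          have h3 := hval a
          simp only [lt_irrefl, if_false, if_true] at h3
          beta_reduce at h1
          omega
  have hsub1 : avoidsIncFrom (m + 1) a ⊆ avoidsIncFrom (m + 1) (a + 1) :=
    fun σ h => ⟨h.1, h.2.1, fun p hp => h.2.2 p (by omega)⟩
  have hsub2 : avoidsIncFrom m a ⊆ avoidsIncFrom m (a + 1) :=
    fun σ h => ⟨h.1, h.2.1, fun p hp => h.2.2 p (by omega)⟩
  have hdisj : Disjoint (avoidsIncFrom m (a + 1) \ avoidsIncFrom m a)
      ((fun u => u * descProd adjSwap a (l + 1)) '' avoidsIncFrom m a) := by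
    rw [Set.disjoint_left]
    rintro _ h ⟨u, hu, rfl⟩
    have h1 := permsBelow_lt h.1.1 ha
    have h2 := hu.1 m le_rfl
    simp only [Perm.mul_apply, descProd_adjSwap_apply] at h1
    grind
  rw [← Set.ncard_sdiff_add_ncard_of_subset hsub1 (avoidsIncFrom_finite _ _), key,
    Set.ncard_union_eq hdisj ((avoidsIncFrom_finite _ _).subset Set.sdiff_subset)
      ((avoidsIncFrom_finite _ _).image _),
    Set.ncard_image_of_injective _ (mul_left_injective _),
    Set.ncard_sdiff_add_ncard_of_subset hsub2 (avoidsIncFrom_finite _ _), add_comm]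

theorem ncard_avoidsIncFrom_add_choose (m a : ℕ) (ha : a + 1 ≤ m) :
    (avoidsIncFrom m (a + 1)).ncard + (m + a + 1).choose a = (m + a + 1).choose (a + 1) := by
  induction m generalizing a with
  | zero => omega
  | succ m ihm =>
    have pascal : ∀ k, (m + 1 + a + 1).choose (k + 1) =
        (m + a + 1).choose k + (m + a + 1).choose (k + 1) := fun k => by
      rw [show m + 1 + a + 1 = (m + a + 1) + 1 by omega, Nat.choose_succ_succ]
    induction a with
    | zero =>
      rcases Nat.eq_zero_or_pos m with rfl | hm
      · rw [avoidsIncFrom_succ_self, ncard_avoidsIncFrom_zero]; rfl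
      · have := ihm 0 hm
        rw [ncard_avoidsIncFrom_succ_succ hm, ncard_avoidsIncFrom_zero]
        simp at this ⊢
        omega
    | succ a iha =>
      have h1 := iha (by omega) (fun k => by
        rw [show m + 1 + a + 1 = (m + a + 1) + 1 by omega, Nat.choose_succ_succ])
      rw [pascal, pascal]
      rw [show m + 1 + a + 1 = m + (a + 1) + 1 by omega] at h1
      rcases (show a + 1 ≤ m by omega).eq_or_lt with rfl | hm
      · rw [avoidsIncFrom_succ_self]
        have := Nat.choose_symm_half (a + 1)
        rw [show 2 * (a + 1) + 1 = a + 1 + (a + 1) + 1 by omega] at this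
        omega
      · have h2 := ihm (a + 1) hm
        rw [ncard_avoidsIncFrom_succ_succ hm]
        omega

theorem ncard_avoids321 (m : ℕ) :
    {σ | σ ∈ permsBelow (m + 1) ∧ Avoids321 σ}.ncard =
      (2 * (m + 1)).choose (m + 1) / (m + 2) := by
  have h : {σ | σ ∈ permsBelow (m + 1) ∧ Avoids321 σ} = avoidsIncFrom (m + 1) (m + 1) := by
    ext σ
    refine ⟨fun h => ⟨h.1, h.2, fun p hp => ?_⟩, fun h => ⟨h.1, h.2.1⟩⟩
    rw [h.1 p hp, h.1 (p + 1) (by omega)]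
    omega
  rw [h]
  have h1 := ncard_avoidsIncFrom_add_choose (m + 1) m le_rfl
  have h2 := Nat.choose_succ_right_eq (2 * (m + 1)) m
  rw [show m + 1 + m + 1 = 2 * (m + 1) by ring] at h1
  rw [show 2 * (m + 1) - m = m + 2 by omega] at h2
  symm
  apply Nat.div_eq_of_eq_mul_left (by omega)
  nlinarith

/-- The inversions of `σ` among the positions below `N`. -/
def inversions (N : ℕ) (σ : Perm ℕ) : Finset (ℕ × ℕ) :=
  {p ∈ Finset.range N ×ˢ Finset.range N | p.1 < p.2 ∧ σ p.2 < σ p.1}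

theorem mem_inversions {N : ℕ} {σ : Perm ℕ} {a b : ℕ} :
    (a, b) ∈ inversions N σ ↔ b < N ∧ a < b ∧ σ b < σ a := by
  simp only [inversions, Finset.mem_filter, Finset.mem_product, Finset.mem_range]
  omega

theorem adjSwap_adjSwap_apply (i p : ℕ) : adjSwap i (adjSwap i p) = p := by
  simp [adjSwap]

theorem adjSwap_lt_adjSwap {i a b : ℕ} (hab : a < b) (h : ¬(a = i ∧ b = i + 1)) :
    adjSwap i a < adjSwap i b := by
  rw [adjSwap_apply, adjSwap_apply]
  split_ifs <;> omega

theorem card_inversions_mul_adjSwap {N i : ℕ} (hi : i + 1 < N) {σ : Perm ℕ}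
    (h : σ i < σ (i + 1)) :
    (inversions N (σ * adjSwap i)).card = (inversions N σ).card + 1 := by
  have key : inversions N (σ * adjSwap i) =
      insert (i, i + 1) ((inversions N σ).image (Prod.map (adjSwap i) (adjSwap i))) := by
    ext ⟨a, b⟩
    simp only [Finset.mem_insert, Finset.mem_image, Prod.exists, Prod.map_apply, Prod.mk.injEq,
      mem_inversions, Perm.mul_apply]
    constructor
    · rintro ⟨hb, hab, hlt⟩
      refine or_iff_not_imp_left.2 fun hne => ⟨adjSwap i a, adjSwap i b, ⟨?_, ?_, hlt⟩,
        adjSwap_adjSwap_apply i a, adjSwap_adjSwap_apply i b⟩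
      · rw [adjSwap_apply]; grind
      · rw [adjSwap_apply, adjSwap_apply]; grind
    · rintro (⟨rfl, rfl⟩ | ⟨c, d, ⟨hb, hab, hlt⟩, rfl, rfl⟩)
      · refine ⟨hi, by omega, ?_⟩
        simpa [adjSwap_apply] using h
      · rw [adjSwap_adjSwap_apply, adjSwap_adjSwap_apply]
        refine ⟨?_, ?_, hlt⟩
        · rw [adjSwap_apply]; grind
        · rw [adjSwap_apply, adjSwap_apply]; grind
  rw [key, Finset.card_insert_of_notMem, Finset.card_image_of_injective]
  · exact (adjSwap i).injective.prodMap (adjSwap i).injective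
  · simp only [Finset.mem_image, Prod.exists, Prod.map_apply, Prod.mk.injEq, mem_inversions,
      not_exists, not_and]
    rintro c d ⟨_, hcd, _⟩ hc hd
    rw [adjSwap_apply] at hc hd
    grind

theorem card_inversions_mul_adjSwap_of_gt {N i : ℕ} (hi : i + 1 < N) {σ : Perm ℕ}
    (h : σ (i + 1) < σ i) :
    (inversions N (σ * adjSwap i)).card + 1 = (inversions N σ).card := by
  have := card_inversions_mul_adjSwap hi (σ := σ * adjSwap i) (by simpa [adjSwap_apply] using h)
  rw [← this, mul_assoc, adjSwap_mul_self, mul_one]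

theorem Avoids321.mul_adjSwap {σ : Perm ℕ} (h : Avoids321 σ) {i : ℕ} (hi : σ (i + 1) < σ i) :
    Avoids321 (σ * adjSwap i) := by
  intro a b c hab hbc habc
  simp only [Perm.mul_apply] at habc
  refine h (adjSwap i a) (adjSwap i b) (adjSwap i c) ?_ ?_ habc <;>
    simp only [adjSwap_apply] at habc ⊢ <;> grind

/-- A permutation containing 321 either has a descent whose removal preserves this, or has two
consecutive descents. -/
theorem exists_descent_of_not_avoids321 {σ : Perm ℕ} (h : ¬ Avoids321 σ) :
    (∃ i, σ (i + 1) < σ i ∧ ¬ Avoids321 (σ * adjSwap i)) ∨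
      ∃ i, σ (i + 1) < σ i ∧ σ (i + 2) < σ (i + 1) := by
  refine or_iff_not_imp_left.2 fun hn => ?_
  push Not at hn
  simp only [Avoids321, not_forall, not_not] at h
  obtain ⟨a, b, c, hab, hbc, h1, h2⟩ := h
  have exd : ∀ x y, x < y → σ y < σ x → ∃ p, x ≤ p ∧ p < y ∧ σ (p + 1) < σ p := by
    intro x y hxy hlt
    by_contra! hc
    have : MonotoneOn σ (Set.Icc x y) := by
      apply monotoneOn_of_le_succ Set.ordConnected_Icc
      intro p _ hp hp'
      exact hc p hp.1 (by simpa using hp'.2)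
    have := this (a := x) (b := y) (by simp; omega) (by simp; omega) hxy.le
    omega
  obtain ⟨p, hp1, hp2, hp⟩ := exd a b hab h1
  obtain ⟨q, hq1, hq2, hq⟩ := exd b c hbc h2
  have not_avoids : ∀ r, ¬(a = r ∧ b = r + 1) → ¬(b = r ∧ c = r + 1) →
      ¬ Avoids321 (σ * adjSwap r) := by
    intro r hab' hbc' hav
    refine hav _ _ _ (adjSwap_lt_adjSwap hab hab') (adjSwap_lt_adjSwap hbc hbc') ?_
    simp only [Perm.mul_apply, adjSwap_adjSwap_apply]
    exact ⟨h1, h2⟩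
  have hP : a = p ∧ b = p + 1 := by
    by_contra hne
    exact not_avoids p hne (by omega) (hn p hp)
  have hQ : b = q ∧ c = q + 1 := by
    by_contra hne
    exact not_avoids q (by omega) hne (hn q hq)
  obtain ⟨rfl, rfl⟩ := hP
  obtain ⟨rfl, rfl⟩ := hQ
  exact ⟨a, h1, h2⟩

theorem descProd_succ' {G : Type*} [Monoid G] (g : ℕ → G) (j l : ℕ) :
    descProd g j (l + 1) = descProd g (j + 1) l * g j := by
  induction l with
  | zero => simp [descProd]
  | succ l ih =>
    rw [descProd, ih, descProd, mul_assoc]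
    congr 2
    omega

/-- Elements `u₀ * u₁ * ⋯ * u_{k-1}` where `uᵢ` is a descending product starting with `g i`. -/
def descNormalForms {G : Type*} [Monoid G] (g : ℕ → G) : ℕ → Set G
  | 0 => {1}
  | k + 1 => {x | ∃ j l, j + l = k + 1 ∧ ∃ u ∈ descNormalForms g k, x = u * descProd g j l}

section Relations

variable {G : Type*} [Monoid G] {g : ℕ → G}

theorem descProd_mul_comm (hcomm : ∀ i j, i + 1 < j → g i * g j = g j * g i) {i j : ℕ} (l : ℕ)
    (h : i + 1 < j ∨ j + l < i) : descProd g j l * g i = g i * descProd g j l := by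
  induction l with
  | zero => simp [descProd]
  | succ l ih =>
    have h1 : g (j + l) * g i = g i * g (j + l) := by
      rcases h with h | h
      · exact (hcomm _ _ (by omega)).symm
      · exact hcomm _ _ (by omega)
    rw [descProd, mul_assoc, ih (by omega), ← mul_assoc, h1, mul_assoc]

theorem descProd_mul_of_gt (hcomm : ∀ i j, i + 1 < j → g i * g j = g j * g i) {n : ℕ}
    (hbraid : ∀ i, i + 1 < n → g i * g (i + 1) * g i = g (i + 1) * g i * g (i + 1))
    {j l m : ℕ} (hm : m + 1 < l) (hl : j + l ≤ n) :
    descProd g j l * g (j + m + 1) = g (j + m) * descProd g j l := by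
  induction l with
  | zero => omega
  | succ l ih =>
    rcases (show m + 1 ≤ l by omega).eq_or_lt with rfl | hlt
    · have h1 := descProd_mul_comm hcomm (i := j + m + 1) (j := j) m (by omega)
      have h2 := hbraid (j + m) (by omega)
      simp only [descProd, mul_assoc, h1]
      simp only [← mul_assoc, ← add_assoc, h2]
    · rw [descProd, mul_assoc, ih hlt (by omega), ← mul_assoc, ← mul_assoc,
        hcomm (j + m) (j + l) (by omega)]

theorem descNormalForms_mul_mem (hsq : ∀ i, g i * g i = 1)
    (hcomm : ∀ i j, i + 1 < j → g i * g j = g j * g i) {n : ℕ}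
    (hbraid : ∀ i, i + 1 < n → g i * g (i + 1) * g i = g (i + 1) * g i * g (i + 1))
    {k i : ℕ} (hk : k ≤ n) (hi : i < k) {x : G} (hx : x ∈ descNormalForms g k) :
    x * g i ∈ descNormalForms g k := by
  induction k generalizing i x with
  | zero => omega
  | succ k ih =>
    obtain ⟨j, l, hjl, u, hu, rfl⟩ := hx
    rcases lt_trichotomy i j with hij | rfl | hij
    · rcases (show i + 1 ≤ j by omega).eq_or_lt with rfl | hij
      · exact ⟨i, l + 1, by omega, u, hu, by rw [descProd_succ', mul_assoc]⟩
      · exact ⟨j, l, hjl, u * g i, ih (by omega) (by omega) hu, by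
          rw [mul_assoc, descProd_mul_comm hcomm l (.inl hij), mul_assoc]⟩
    · obtain ⟨l, rfl⟩ : ∃ l', l = l' + 1 := ⟨l - 1, by omega⟩
      exact ⟨i + 1, l, by omega, u, hu, by rw [descProd_succ', mul_assoc, mul_assoc, hsq, mul_one]⟩
    · obtain ⟨m, rfl⟩ := Nat.exists_eq_add_of_lt hij
      exact ⟨j, l, hjl, u * g (j + m), ih (by omega) (by omega) hu, by
        rw [mul_assoc, descProd_mul_of_gt hcomm hbraid (by omega) (by omega), mul_assoc]⟩

end Relations

theorem mul_mul_eq_of_pow_three {G : Type*} [Group G] {a b : G} (ha : a * a = 1) (hb : b * b = 1)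
    (h : (a * b) ^ 3 = 1) : a * b * a = b * a * b := by
  have ha' : a⁻¹ = a := inv_eq_of_mul_eq_one_left ha
  have hb' : b⁻¹ = b := inv_eq_of_mul_eq_one_left hb
  have : a * b * a = (b * a * b)⁻¹ := by
    rw [eq_inv_iff_mul_eq_one, ← h]
    simp only [pow_succ, pow_zero, one_mul, mul_assoc]
  rw [this]
  simp [ha', hb', mul_assoc]

theorem mul_comm_of_pow_two {G : Type*} [Group G] {a b : G} (ha : a * a = 1) (hb : b * b = 1)
    (h : (a * b) ^ 2 = 1) : a * b = b * a := by
  have ha' : a⁻¹ = a := inv_eq_of_mul_eq_one_left ha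
  have hb' : b⁻¹ = b := inv_eq_of_mul_eq_one_left hb
  rw [sq, ← eq_inv_iff_mul_eq_one] at h
  rw [h]
  simp [ha', hb']

section TypeA

variable {n : ℕ} {W : Type*} [Group W]

theorem adjSwap_isLiftable (n : ℕ) :
    (CoxeterMatrix.A n).IsLiftable fun i : Fin n => adjSwap i := by
  intro i j
  simp only [CoxeterMatrix.A, Matrix.of_apply]
  split_ifs with h1 h2
  · simp [h1, adjSwap_mul_self]
  · ext p
    simp only [pow_succ, pow_zero, one_mul, Perm.mul_apply, adjSwap_apply, Perm.one_apply]
    grind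
  · ext p
    simp only [pow_succ, pow_zero, one_mul, Perm.mul_apply, adjSwap_apply, Perm.one_apply]
    grind

/-- The action of the type `A` Coxeter group on `ℕ` by adjacent transpositions. -/
noncomputable def permHom (cs : CoxeterSystem (CoxeterMatrix.A n) W) : W →* Perm ℕ :=
  cs.lift ⟨_, adjSwap_isLiftable n⟩

/-- The simple reflections, indexed by natural numbers. -/
noncomputable def natSimple (cs : CoxeterSystem (CoxeterMatrix.A n) W) (i : ℕ) : W :=
  if h : i < n then cs.simple ⟨i, h⟩ else 1

variable (cs : CoxeterSystem (CoxeterMatrix.A n) W)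

theorem permHom_simple (i : Fin n) : permHom cs (cs.simple i) = adjSwap i :=
  cs.lift_apply_simple (adjSwap_isLiftable n) i

theorem natSimple_mul_self (i : ℕ) : natSimple cs i * natSimple cs i = 1 := by
  unfold natSimple
  split_ifs <;> simp

theorem simple_comm {i j : Fin n} (h : (CoxeterMatrix.A n) i j = 2) :
    cs.simple i * cs.simple j = cs.simple j * cs.simple i :=
  mul_comm_of_pow_two (by simp) (by simp) (h ▸ cs.simple_mul_simple_pow i j)

theorem simple_braid {i j : Fin n} (h : (CoxeterMatrix.A n) i j = 3) :
    cs.simple i * cs.simple j * cs.simple i = cs.simple j * cs.simple i * cs.simple j :=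
  mul_mul_eq_of_pow_three (by simp) (by simp) (h ▸ cs.simple_mul_simple_pow i j)

theorem A_eq_two {i j : Fin n} (h : (i : ℕ) + 1 < j ∨ (j : ℕ) + 1 < i) :
    (CoxeterMatrix.A n) i j = 2 := by
  simp only [CoxeterMatrix.A, Matrix.of_apply, Fin.ext_iff]
  grind

theorem A_eq_three {i j : Fin n} (h : (i : ℕ) + 1 = j) : (CoxeterMatrix.A n) i j = 3 := by
  simp only [CoxeterMatrix.A, Matrix.of_apply, Fin.ext_iff]
  grind

theorem natSimple_comm (i j : ℕ) (h : i + 1 < j) :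
    natSimple cs i * natSimple cs j = natSimple cs j * natSimple cs i := by
  unfold natSimple
  split_ifs
  · exact simple_comm cs (A_eq_two (.inl h))
  all_goals simp

theorem natSimple_braid (i : ℕ) (h : i + 1 < n) : natSimple cs i * natSimple cs (i + 1) *
    natSimple cs i = natSimple cs (i + 1) * natSimple cs i * natSimple cs (i + 1) := by
  simp only [natSimple, h, show i < n by omega, dif_pos]
  exact simple_braid cs (A_eq_three rfl)

theorem mem_descNormalForms (w : W) : w ∈ descNormalForms (natSimple cs) n := by
  induction w using cs.simple_induction_right with
  | one =>
    have (k : ℕ) : (1 : W) ∈ descNormalForms (natSimple cs) k := by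
      induction k with
      | zero => rfl
      | succ k ih => exact ⟨k + 1, 0, rfl, 1, ih, by simp [descProd]⟩
    exact this n
  | mul_simple_right w i hw =>
    have := descNormalForms_mul_mem (natSimple_mul_self cs) (natSimple_comm cs)
      (natSimple_braid cs) le_rfl i.isLt hw
    simpa [natSimple] using this

theorem permHom_descProd {j l : ℕ} (h : j + l ≤ n) :
    permHom cs (descProd (natSimple cs) j l) = descProd adjSwap j l := by
  induction l with
  | zero => simp [descProd]
  | succ l ih =>
    simp [descProd, ih (by omega), natSimple, show j + l < n by omega, permHom_simple]

theorem permHom_mem_permsBelow {k : ℕ} (hk : k ≤ n) {w : W}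
    (hw : w ∈ descNormalForms (natSimple cs) k) : permHom cs w ∈ permsBelow (k + 1) := by
  induction k generalizing w with
  | zero => rw [Set.mem_singleton_iff.1 hw, map_one]; exact fun _ _ => rfl
  | succ k ih =>
    obtain ⟨j, l, hjl, u, hu, rfl⟩ := hw
    rw [map_mul, permHom_descProd cs (by omega)]
    exact mul_descProd_mem hjl (ih (by omega) hu)

theorem permHom_injOn {k : ℕ} (hk : k ≤ n) :
    Set.InjOn (permHom cs) (descNormalForms (natSimple cs) k) := by
  induction k with
  | zero => exact Set.injOn_singleton _ _
  | succ k ih =>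
    rintro _ ⟨j, l, hjl, u, hu, rfl⟩ _ ⟨j', l', hjl', u', hu', rfl⟩ h
    rw [map_mul, map_mul, permHom_descProd cs (by omega), permHom_descProd cs (by omega)] at h
    have top : ∀ {j l u}, j + l = k + 1 → u ∈ descNormalForms (natSimple cs) k →
        (permHom cs u * descProd adjSwap j l) j = k + 1 := by
      intro j l u hjl hu
      rw [Perm.mul_apply, descProd_adjSwap_apply]
      simpa [hjl] using permHom_mem_permsBelow cs (by omega) hu (k + 1) le_rfl
    have hjj : j = j' := by
      apply (permHom cs u * descProd adjSwap j l).injective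
      rw [top hjl hu, h, top hjl' hu']
    subst hjj
    obtain rfl : l = l' := by omega
    rw [ih (by omega) hu hu' (mul_right_cancel h)]

theorem permHom_surjOn {k : ℕ} (hk : k ≤ n) {σ : Perm ℕ} (hσ : σ ∈ permsBelow (k + 1)) :
    ∃ w, permHom cs w = σ := by
  induction k generalizing σ with
  | zero =>
    refine ⟨1, ?_⟩
    rw [map_one]
    ext p
    rcases Nat.eq_zero_or_pos p with rfl | hp
    · have := permsBelow_lt hσ zero_lt_one
      simp; omega
    · exact (hσ p hp).symm
  | succ k ih =>
    have hj : σ (σ.symm (k + 1)) = k + 1 := by simp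
    have hjk : σ.symm (k + 1) ≤ k + 1 := by
      by_contra! hc
      have := hσ _ hc
      omega
    obtain ⟨l, hl⟩ := Nat.exists_eq_add_of_le hjk
    obtain ⟨u, hu, h⟩ := exists_descProd_factor hσ hl.symm hj
    obtain ⟨w, rfl⟩ := ih (by omega) hu
    refine ⟨w * descProd (natSimple cs) (σ.symm (k + 1)) l, ?_⟩
    rw [map_mul, permHom_descProd cs (by omega), ← h]

theorem permHom_injective : Function.Injective (permHom cs) := fun _ _ h =>
  permHom_injOn cs le_rfl (mem_descNormalForms cs _) (mem_descNormalForms cs _) h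

theorem permHom_mem (w : W) : permHom cs w ∈ permsBelow (n + 1) :=
  permHom_mem_permsBelow cs le_rfl (mem_descNormalForms cs w)

theorem lt_of_descent {w : W} {i : ℕ} (h : permHom cs w (i + 1) < permHom cs w i) : i < n := by
  by_contra! hc
  have h1 := permHom_mem cs w (i + 1) (by omega)
  rcases hc.eq_or_lt with rfl | hc
  · have := permsBelow_lt (permHom_mem cs w) n.lt_succ_self
    omega
  · have := permHom_mem cs w i (by omega)
    omega

theorem card_inversions_permHom_le (w : W) :
    (inversions (n + 1) (permHom cs w)).card ≤ cs.length w := by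
  obtain ⟨ω, hω, rfl⟩ := cs.exists_isReduced w
  rw [hω.eq]
  clear hω
  induction ω using List.reverseRecOn with
  | nil =>
    simp only [cs.wordProd_nil, map_one, List.length_nil, Nat.le_zero, Finset.card_eq_zero]
    refine Finset.eq_empty_of_forall_notMem fun ⟨a, b⟩ h => ?_
    rw [mem_inversions] at h
    simp at h
    omega
  | append_singleton ω i ih =>
    simp only [cs.wordProd_append, cs.wordProd_singleton, map_mul, permHom_simple, List.length_append,
      List.length_singleton]
    have hi : (i : ℕ) + 1 < n + 1 := by omega
    rcases lt_or_gt_of_ne ((permHom cs (cs.wordProd ω)).injective.ne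
      (show (i : ℕ) ≠ i + 1 by omega)) with h | h
    · rw [card_inversions_mul_adjSwap hi h]; omega
    · have := card_inversions_mul_adjSwap_of_gt hi h; omega

theorem length_le_card_inversions (w : W) :
    cs.length w ≤ (inversions (n + 1) (permHom cs w)).card := by
  induction hN : (inversions (n + 1) (permHom cs w)).card using Nat.strong_induction_on
    generalizing w with
  | _ N ih =>
    by_cases hd : ∃ i, permHom cs w (i + 1) < permHom cs w i
    · obtain ⟨i, hi⟩ := hd
      have hin := lt_of_descent cs hi
      have h1 := card_inversions_mul_adjSwap_of_gt (N := n + 1) (by omega) hi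
      have hm : permHom cs (w * cs.simple ⟨i, hin⟩) = permHom cs w * adjSwap i := by
        rw [map_mul, permHom_simple]
      rw [← hm] at h1
      have h2 := ih _ (by omega) (w * cs.simple ⟨i, hin⟩) rfl
      have h3 := cs.length_mul_le (w * cs.simple ⟨i, hin⟩) (cs.simple ⟨i, hin⟩)
      rw [mul_assoc, cs.simple_mul_simple_self, mul_one, cs.length_simple] at h3
      omega
    · push Not at hd
      have : permHom cs w = 1 := perm_eq_one_of_lt_succ fun p =>
        lt_of_le_of_ne (hd p) ((permHom cs w).injective.ne (by omega))
      obtain rfl : w = 1 := permHom_injective cs (by rw [this, map_one])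
      simp

theorem length_eq_card_inversions (w : W) :
    cs.length w = (inversions (n + 1) (permHom cs w)).card :=
  le_antisymm (length_le_card_inversions cs w) (card_inversions_permHom_le cs w)

theorem length_mul_simple_of_descent {w : W} {i : Fin n}
    (h : permHom cs w (i + 1) < permHom cs w i) :
    cs.length (w * cs.simple i) + 1 = cs.length w := by
  rw [length_eq_card_inversions, length_eq_card_inversions, map_mul, permHom_simple,
    card_inversions_mul_adjSwap_of_gt (by omega) h]

theorem descent_of_length_mul_simple {w : W} {i : Fin n}
    (h : cs.length (w * cs.simple i) < cs.length w) :
    permHom cs w (i + 1) < permHom cs w i := by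
  rw [length_eq_card_inversions, length_eq_card_inversions, map_mul, permHom_simple] at h
  by_contra! hc
  have hlt := lt_of_le_of_ne hc ((permHom cs w).injective.ne (by omega))
  have := card_inversions_mul_adjSwap (N := n + 1) (by omega) hlt
  omega

theorem CommEquiv.append {B : Type*} {M : CoxeterMatrix B} {ω₁ ω₂ : List B}
    (h : CommEquiv M ω₁ ω₂) (v : List B) : CommEquiv M (ω₁ ++ v) (ω₂ ++ v) := by
  refine Relation.ReflTransGen.lift (· ++ v) ?_ _ _ h
  rintro _ _ ⟨l, r, s, t, hst, rfl, rfl⟩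
  exact ⟨l, r ++ v, s, t, hst, by simp, by simp⟩

theorem CommEquiv.perm {B : Type*} {M : CoxeterMatrix B} {ω₁ ω₂ : List B}
    (h : CommEquiv M ω₁ ω₂) : ω₁.Perm ω₂ := by
  induction h with
  | refl => rfl
  | tail _ h ih =>
    obtain ⟨l, r, s, t, -, rfl, rfl⟩ := h
    exact ih.trans ((List.Perm.swap t s r).append_left l)

theorem isRedexOf_of_append_singleton {w : W} {ω : List (Fin n)} {s : Fin n}
    (h : IsRedexOf cs (ω ++ [s]) w) : IsRedexOf cs ω (w * cs.simple s) ∧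
      permHom cs w (s + 1) < permHom cs w s := by
  obtain ⟨rfl, hr⟩ := h
  have hω : cs.IsReduced ω := by simpa using hr.take ω.length
  have hp : cs.wordProd (ω ++ [s]) * cs.simple s = cs.wordProd ω := by simp [cs.wordProd_append]
  refine ⟨⟨hp.symm, hω⟩, descent_of_length_mul_simple cs ?_⟩
  rw [hp, hr.eq, hω.eq]
  simp

theorem isRedexOf_append_singleton {w : W} {ω : List (Fin n)} {s : Fin n}
    (h : IsRedexOf cs ω (w * cs.simple s)) (hs : permHom cs w (s + 1) < permHom cs w s) :
    IsRedexOf cs (ω ++ [s]) w := by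
  have hp : cs.wordProd (ω ++ [s]) = w := by simp [cs.wordProd_append, h.1]
  refine ⟨hp, ?_⟩
  rw [CoxeterSystem.IsReduced, hp, ← length_mul_simple_of_descent cs hs, ← h.1, h.2.eq]
  simp

theorem isFC_of_avoids321 {w : W} (h : Avoids321 (permHom cs w)) : IsFC cs w := by
  intro ω₁ ω₂ h₁ h₂
  induction hN : cs.length w using Nat.strong_induction_on generalizing w ω₁ ω₂ with
  | _ N ih =>
    have hlen : ω₁.length = ω₂.length := by
      rw [← h₁.2.eq, ← h₂.2.eq, h₁.1, h₂.1]
    rcases List.eq_nil_or_concat' ω₁ with rfl | ⟨r₁, s, rfl⟩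
    · obtain rfl := List.length_eq_zero_iff.1 hlen.symm
      exact .refl
    rcases List.eq_nil_or_concat' ω₂ with rfl | ⟨r₂, t, rfl⟩
    · simp at hlen
    obtain ⟨h₁', hs⟩ := isRedexOf_of_append_singleton cs h₁
    obtain ⟨h₂', ht⟩ := isRedexOf_of_append_singleton cs h₂
    have hs' := length_mul_simple_of_descent cs hs
    have ht' := length_mul_simple_of_descent cs ht
    have avs : Avoids321 (permHom cs (w * cs.simple s)) := by
      rw [map_mul, permHom_simple]; exact h.mul_adjSwap hs
    have avt : Avoids321 (permHom cs (w * cs.simple t)) := by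
      rw [map_mul, permHom_simple]; exact h.mul_adjSwap ht
    by_cases hst : s = t
    · subst hst
      exact (ih _ (by omega) avs r₁ r₂ h₁' h₂' rfl).append [s]
    have hne : (s : ℕ) ≠ t := fun h => hst (Fin.ext h)
    have hne1 : (s : ℕ) + 1 ≠ t := fun e => by
      rw [← e] at ht
      exact h s (s + 1) (s + 1 + 1) (by omega) (by omega) ⟨hs, ht⟩
    have hne2 : (t : ℕ) + 1 ≠ s := fun e => by
      rw [← e] at hs
      exact h t (t + 1) (t + 1 + 1) (by omega) (by omega) ⟨ht, hs⟩
    have hM : (CoxeterMatrix.A n) s t = 2 := A_eq_two (by omega)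
    have hM' : (CoxeterMatrix.A n) t s = 2 := A_eq_two (by omega)
    obtain ⟨u, hu, hprod⟩ := cs.exists_isReduced (w * cs.simple s * cs.simple t)
    have hts : permHom cs (w * cs.simple s) (t + 1) < permHom cs (w * cs.simple s) t := by
      rw [map_mul, permHom_simple, Perm.mul_apply, Perm.mul_apply, adjSwap_apply, adjSwap_apply]
      grind
    have hst' : permHom cs (w * cs.simple t) (s + 1) < permHom cs (w * cs.simple t) s := by
      rw [map_mul, permHom_simple, Perm.mul_apply, Perm.mul_apply, adjSwap_apply, adjSwap_apply]
      grind
    have hcomm : w * cs.simple s * cs.simple t = w * cs.simple t * cs.simple s := by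
      rw [mul_assoc, simple_comm cs hM, mul_assoc]
    have c₁ := ih _ (by omega) avs r₁ (u ++ [t]) h₁'
      (isRedexOf_append_singleton cs ⟨hprod.symm, hu⟩ hts) rfl
    have c₂ := ih _ (by omega) avt (u ++ [s]) r₂
      (isRedexOf_append_singleton cs ⟨hprod.symm.trans hcomm, hu⟩ hst') h₂' rfl
    refine (c₁.append [s]).trans (.trans (.single ?_) (c₂.append [t]))
    exact ⟨u, [], t, s, hM', by simp, by simp⟩

theorem exists_braid_of_not_avoids321 {w : W} (h : ¬ Avoids321 (permHom cs w)) :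
    ∃ (a b : List (Fin n)) (s t : Fin n), s ≠ t ∧
      IsRedexOf cs (a ++ [s, t, s] ++ b) w ∧ IsRedexOf cs (a ++ [t, s, t] ++ b) w := by
  induction hN : cs.length w using Nat.strong_induction_on generalizing w with
  | _ N ih =>
    rcases exists_descent_of_not_avoids321 h with ⟨i, hi, hi'⟩ | ⟨i, hi, hi'⟩
    · obtain ⟨i, rfl⟩ : ∃ i' : Fin n, (i' : ℕ) = i := ⟨⟨i, lt_of_descent cs hi⟩, rfl⟩
      have hl := length_mul_simple_of_descent cs hi
      rw [← permHom_simple cs, ← map_mul] at hi'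
      obtain ⟨a, b, s, t, hst, h₁, h₂⟩ := ih _ (by omega) hi' rfl
      refine ⟨a, b ++ [i], s, t, hst, ?_, ?_⟩
      · simpa using isRedexOf_append_singleton cs h₁ hi
      · simpa using isRedexOf_append_singleton cs h₂ hi
    · have hin := lt_of_descent cs hi
      have hin' := lt_of_descent cs hi'
      have key : ∀ s t : Fin n, ((s : ℕ) = i ∧ (t : ℕ) = i + 1 ∨ (t : ℕ) = i ∧ (s : ℕ) = i + 1) →
          ∀ a, IsRedexOf cs a (w * cs.simple s * cs.simple t * cs.simple s) →
            IsRedexOf cs (a ++ [s, t, s]) w := by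
        intro s t hst a ha
        have h1 := isRedexOf_append_singleton cs ha (by
          simp only [map_mul, permHom_simple, Perm.mul_apply, adjSwap_apply]; grind)
        have h2 := isRedexOf_append_singleton cs h1 (by
          simp only [map_mul, permHom_simple, Perm.mul_apply, adjSwap_apply]; grind)
        simpa using isRedexOf_append_singleton cs h2 (by grind)
      obtain ⟨a, ha, hprod⟩ := cs.exists_isReduced
        (w * cs.simple ⟨i, hin⟩ * cs.simple ⟨i + 1, hin'⟩ * cs.simple ⟨i, hin⟩)
      have hb := simple_braid cs (A_eq_three (i := ⟨i, hin⟩) (j := ⟨i + 1, hin'⟩) rfl)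
      refine ⟨a, [], ⟨i, hin⟩, ⟨i + 1, hin'⟩, by simp, ?_, ?_⟩
      · simpa using key _ _ (.inl ⟨rfl, rfl⟩) a ⟨hprod.symm, ha⟩
      · refine List.append_nil _ ▸ key _ _ (.inr ⟨rfl, rfl⟩) a ⟨hprod.symm.trans ?_, ha⟩
        simp only [mul_assoc] at hb ⊢
        rw [hb]

theorem isFC_iff_avoids321 (w : W) : IsFC cs w ↔ Avoids321 (permHom cs w) := by
  refine ⟨fun h => ?_, isFC_of_avoids321 cs⟩
  by_contra hn
  obtain ⟨a, b, s, t, hst, h₁, h₂⟩ := exists_braid_of_not_avoids321 cs hn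
  have := (h _ _ h₁ h₂).perm.count_eq s
  simp [hst.symm] at this

theorem card_isFC : Nat.card {w : W // IsFC cs w} =
    (2 * (n + 1)).choose (n + 1) / (n + 2) := by
  rw [← ncard_avoids321 n]
  have himg : {σ | σ ∈ permsBelow (n + 1) ∧ Avoids321 σ} = permHom cs '' {w | IsFC cs w} := by
    ext σ
    constructor
    · rintro ⟨hσ, hav⟩
      obtain ⟨w, rfl⟩ := permHom_surjOn cs le_rfl hσ
      exact ⟨w, (isFC_iff_avoids321 cs w).2 hav, rfl⟩
    · rintro ⟨w, hw, rfl⟩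
      exact ⟨permHom_mem cs w, (isFC_iff_avoids321 cs w).1 hw⟩
  rw [himg, Set.ncard_image_of_injective _ (permHom_injective cs)]
  rfl

end TypeA

/-- The number of fully commutative elements of the type `Aₙ` Coxeter group is the Catalan
number `C_{n+1} = (1/(n+2)) * binomial (2(n+1)) (n+1)`. -/
theorem card_fc_An (n : ℕ) {W : Type*} [Group W]
    (cs : CoxeterSystem (CoxeterMatrix.Aₙ n) W) :
    Nat.card {w : W // IsFC cs w} = (2 * (n + 1)).choose (n + 1) / (n + 2) := by
  exact card_isFC cs
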